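/- Let F : ℝ^q → ℝ be convex and differentiable with ∇F being L_F-Lipschitz, where L_F > 0, and let η > 0. Let G be a symmetric positive definite q×q real matrix such that G − (L_F·η)·I is positive semidefinite. Let d, w, x_k, x_star ∈ ℝ^q, set μ := d + w and x_{k+1} := x_k − η·G⁻¹·μ. Then ⟨x_{k+1} − x_star, G·(x_{k+1} − x_star)⟩ ≤ ⟨x_k − x_star, G·(x_k − x_star)⟩ − 2η·(F(x_{k+1}) − F(x_star)) − 2η·⟨d − ∇F(x_k), x_{k+1} − x_star⟩ + 2η·⟨w, x_star − x_{k+1}⟩. -/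

import Mathlib

open scoped RealInnerProductSpace
open Matrix

section Gradient

variable {E : Type*} [NormedAddCommGroup E] [InnerProductSpace ℝ E] [CompleteSpace E]
  {F : E → ℝ}

theorem Differentiable.hasDerivAt_comp_lineMap_gradient (hF : Differentiable ℝ F) (x y : E)
    (t : ℝ) :
    HasDerivAt (fun s : ℝ => F (AffineMap.lineMap x y s))
      ⟪gradient F (AffineMap.lineMap x y t), y - x⟫ t := by
  rw [inner_gradient_left]
  exact (hF _).hasFDerivAt.comp_hasDerivAt t AffineMap.hasDerivAt_lineMap

/-- A differentiable convex function lies above its tangent hyperplanes. -/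
theorem ConvexOn.add_inner_gradient_le (hconv : ConvexOn ℝ Set.univ F)
    (hF : Differentiable ℝ F) (x y : E) :
    F x + ⟪gradient F x, y - x⟫ ≤ F y := by
  have hline : ConvexOn ℝ Set.univ (fun s : ℝ => F (AffineMap.lineMap x y s)) :=
    hconv.comp_affineMap (AffineMap.lineMap x y)
  have h := hline.le_slope_of_hasDerivAt (Set.mem_univ 0) (Set.mem_univ 1) zero_lt_one
    (hF.hasDerivAt_comp_lineMap_gradient x y 0)
  simp only [slope_def_field, AffineMap.lineMap_apply_zero, AffineMap.lineMap_apply_one,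
    sub_zero, div_one] at h
  linarith

/-- The descent lemma for functions with Lipschitz gradient. -/
theorem Differentiable.le_add_inner_gradient_add_sq (hF : Differentiable ℝ F) {L : ℝ}
    (hlip : ∀ x y : E, ‖gradient F x - gradient F y‖ ≤ L * ‖x - y‖) (x y : E) :
    F y ≤ F x + ⟪gradient F x, y - x⟫ + L / 2 * ‖y - x‖ ^ 2 := by
  have hderiv : ∀ t : ℝ, HasDerivAt
      (fun s : ℝ => s * ⟪gradient F x, y - x⟫ + L / 2 * ‖y - x‖ ^ 2 * s ^ 2
        - F (AffineMap.lineMap x y s))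
      (⟪gradient F x, y - x⟫ + L * ‖y - x‖ ^ 2 * t
        - ⟪gradient F (AffineMap.lineMap x y t), y - x⟫) t := by
    intro t
    refine ((((hasDerivAt_id t).mul_const ⟪gradient F x, y - x⟫).add
      ((hasDerivAt_pow 2 t).const_mul (L / 2 * ‖y - x‖ ^ 2))).sub
      (hF.hasDerivAt_comp_lineMap_gradient x y t)).congr_deriv ?_
    norm_num
    ring
  have hmono := monotoneOn_of_hasDerivWithinAt_nonneg (convex_Icc (0 : ℝ) 1)
    (fun t _ => (hderiv t).continuousAt.continuousWithinAt)
    (fun t _ => (hderiv t).hasDerivWithinAt) (by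
      intro t ht
      rw [interior_Icc] at ht
      have hcs := real_inner_le_norm
        (gradient F (AffineMap.lineMap x y t) - gradient F x) (y - x)
      have hnorm : ‖gradient F (AffineMap.lineMap x y t) - gradient F x‖
          ≤ L * (t * ‖y - x‖) := by
        refine (hlip _ _).trans_eq ?_
        rw [AffineMap.lineMap_apply_module', add_sub_cancel_right, norm_smul,
          Real.norm_of_nonneg ht.1.le]
      have hmul := mul_le_mul_of_nonneg_right hnorm (norm_nonneg (y - x))
      rw [inner_sub_left] at hcs
      linarith)
  have h := hmono (Set.left_mem_Icc.2 zero_le_one) (Set.right_mem_Icc.2 zero_le_one) zero_le_one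
  simp only [AffineMap.lineMap_apply_zero, AffineMap.lineMap_apply_one] at h
  linarith

/-- Three-point inequality for convex functions with Lipschitz gradient. -/
theorem ConvexOn.sub_le_inner_gradient_add_sq (hconv : ConvexOn ℝ Set.univ F)
    (hF : Differentiable ℝ F) {L : ℝ}
    (hlip : ∀ x y : E, ‖gradient F x - gradient F y‖ ≤ L * ‖x - y‖) (x y z : E) :
    F y - F z ≤ ⟪gradient F x, y - z⟫ + L / 2 * ‖y - x‖ ^ 2 := by
  have hupper := hF.le_add_inner_gradient_add_sq hlip x y
  have hlower := hconv.add_inner_gradient_le hF x z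
  have hinner : ⟪gradient F x, y - z⟫ = ⟪gradient F x, y - x⟫ - ⟪gradient F x, z - x⟫ := by
    rw [← inner_sub_right, sub_sub_sub_cancel_right]
  linarith

end Gradient

namespace Matrix

variable {n : Type*} [Fintype n] [DecidableEq n]

theorem PosSemidef.mul_norm_sq_le_inner_toEuclideanLin {A : Matrix n n ℝ} {c : ℝ}
    (hA : (A - c • (1 : Matrix n n ℝ)).PosSemidef) (v : EuclideanSpace ℝ n) :
    c * ‖v‖ ^ 2 ≤ ⟪v, toEuclideanLin A v⟫ := by
  have h := (isPositive_toEuclideanLin_iff.2 hA).re_inner_nonneg_right v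
  simp only [map_sub, map_smul, LinearMap.sub_apply, LinearMap.smul_apply, toLpLin_one,
    LinearMap.id_apply, inner_sub_right, real_inner_smul_right, real_inner_self_eq_norm_sq,
    RCLike.re_to_real] at h
  linarith

theorem toEuclideanLin_apply_inv_apply {A : Matrix n n ℝ} (hA : IsUnit A)
    (v : EuclideanSpace ℝ n) : toEuclideanLin A (toEuclideanLin A⁻¹ v) = v := by
  rw [← LinearMap.comp_apply, ← toLpLin_mul_same,
    mul_nonsing_inv A ((isUnit_iff_isUnit_det A).1 hA), toLpLin_one, LinearMap.id_apply]

theorem IsHermitian.inner_toEuclideanLin_add {A : Matrix n n ℝ} (hA : A.IsHermitian)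
    (u v : EuclideanSpace ℝ n) :
    ⟪u + v, toEuclideanLin A (u + v)⟫
      = ⟪u, toEuclideanLin A u⟫ + 2 * ⟪u, toEuclideanLin A v⟫ + ⟪v, toEuclideanLin A v⟫ := by
  have hsymm : ⟪v, toEuclideanLin A u⟫ = ⟪u, toEuclideanLin A v⟫ := by
    rw [real_inner_comm, isSymmetric_toEuclideanLin_iff.2 hA u v]
  rw [map_add, inner_add_left, inner_add_right, inner_add_right, hsymm]
  ring

end Matrix

/-- Lemma 8 of the appendix, stated deterministically. -/
theorem preconditioned_iterate_contraction
    (q : ℕ) (F : EuclideanSpace ℝ (Fin q) → ℝ) (L_F : ℝ) (hLF : 0 < L_F)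
    (hconv : ConvexOn ℝ Set.univ F) (hdiff : Differentiable ℝ F)
    (hlip : ∀ x y : EuclideanSpace ℝ (Fin q),
      ‖gradient F x - gradient F y‖ ≤ L_F * ‖x - y‖)
    (η : ℝ) (hη : 0 < η)
    (G : Matrix (Fin q) (Fin q) ℝ) (hG : G.PosDef)
    (hGI : (G - (L_F * η) • (1 : Matrix (Fin q) (Fin q) ℝ)).PosSemidef)
    (d w xk xstar : EuclideanSpace ℝ (Fin q))
    (μ xk1 : EuclideanSpace ℝ (Fin q))
    (hμ : μ = d + w) (hxk1 : xk1 = xk - η • Matrix.toEuclideanLin G⁻¹ μ) :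
    ⟪xk1 - xstar, Matrix.toEuclideanLin G (xk1 - xstar)⟫
      ≤ ⟪xk - xstar, Matrix.toEuclideanLin G (xk - xstar)⟫
        - 2 * η * (F xk1 - F xstar)
        - 2 * η * ⟪d - gradient F xk, xk1 - xstar⟫
        + 2 * η * ⟪w, xstar - xk1⟫ := by
  have hstep : toEuclideanLin G (xk - xk1) = η • (d + w) := by
    rw [hxk1, sub_sub_cancel, map_smul, toEuclideanLin_apply_inv_apply hG.isUnit, hμ]
  have hexpand := hG.isHermitian.inner_toEuclideanLin_add (xk1 - xstar) (xk - xk1)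
  rw [add_comm (xk1 - xstar), sub_add_sub_cancel, hstep, real_inner_smul_right,
    inner_add_right, real_inner_comm d, real_inner_comm w, ← hstep] at hexpand
  have hquad := hGI.mul_norm_sq_le_inner_toEuclideanLin (xk - xk1)
  have hF := mul_le_mul_of_nonneg_left
    (hconv.sub_le_inner_gradient_add_sq hdiff hlip xk xk1 xstar) hη.le
  rw [norm_sub_rev] at hF
  rw [inner_sub_left d, ← neg_sub xk1 xstar, inner_neg_right]
  linarith
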